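/- For every real t > 0 and every real x ≥ 1, Σ_{m≤x} f_t(m) log m = Σ_{k,ℓ ≥ 1, kℓ≤x} f_t(k) Λ(ℓ) (1 − ℓ^{−t}). -/

import Mathlib

open Filter Finset

/-- `f_t(m) = Σ_{d∣m} μ(d)/d^t`. -/
noncomputable def ft (t : ℝ) (m : ℕ) : ℝ :=
  ∑ d ∈ m.divisors, (ArithmeticFunction.moebius d : ℝ) / (d : ℝ) ^ t

namespace ArithmeticFunction

open scoped ArithmeticFunction.zeta ArithmeticFunction.Moebius

lemma pmul_log_mul (f g : ArithmeticFunction ℝ) :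
    pmul log (f * g) = pmul log f * g + f * pmul log g := by
  ext n
  simp only [pmul_apply, add_apply, mul_apply, log_apply, Finset.mul_sum,
    ← Finset.sum_add_distrib]
  refine Finset.sum_congr rfl fun p hp => ?_
  obtain ⟨rfl, hn⟩ := Nat.mem_divisorsAntidiagonal.1 hp
  obtain ⟨h1, h2⟩ := mul_ne_zero_iff.1 hn
  rw [Nat.cast_mul, Real.log_mul (Nat.cast_ne_zero.2 h1) (Nat.cast_ne_zero.2 h2)]
  ring

lemma pmul_mul_of_map_mul {h : ArithmeticFunction ℝ} (hh : ∀ m n, h (m * n) = h m * h n)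
    (f g : ArithmeticFunction ℝ) : pmul h (f * g) = pmul h f * pmul h g := by
  ext n
  simp only [pmul_apply, mul_apply, Finset.mul_sum]
  refine Finset.sum_congr rfl fun p hp => ?_
  rw [← (Nat.mem_divisorsAntidiagonal.1 hp).1, hh]
  ring

lemma pmul_log_moebius :
    pmul log (μ : ArithmeticFunction ℝ) = -((μ : ArithmeticFunction ℝ) * Λ) := by
  have h : pmul log (μ : ArithmeticFunction ℝ) * (ζ : ArithmeticFunction ℝ) = -Λ := by
    ext n
    rw [coe_mul_zeta_apply, neg_apply, ← sum_moebius_mul_log_eq]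
    exact Finset.sum_congr rfl fun d _ => mul_comm _ _
  calc pmul log (μ : ArithmeticFunction ℝ)
      = pmul log (μ : ArithmeticFunction ℝ) * ((ζ : ArithmeticFunction ℝ) * μ) := by
        rw [coe_zeta_mul_coe_moebius, mul_one]
    _ = -((μ : ArithmeticFunction ℝ) * Λ) := by rw [← mul_assoc, h]; ring

lemma pmul_log_zeta_mul_pmul_moebius {h : ArithmeticFunction ℝ}
    (hh : ∀ m n, h (m * n) = h m * h n) :
    pmul log ((ζ : ArithmeticFunction ℝ) * pmul h μ) =
      ((ζ : ArithmeticFunction ℝ) * pmul h μ) * (Λ - pmul h Λ) := by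
  have hz : pmul log (ζ : ArithmeticFunction ℝ) = Λ * ζ := by
    rw [pmul_zeta, vonMangoldt_mul_zeta]
  have hm : pmul log (pmul h (μ : ArithmeticFunction ℝ)) = -(pmul h μ * pmul h Λ) := by
    rw [← pmul_mul_of_map_mul hh, ← pmul_assoc, pmul_comm log h, pmul_assoc, pmul_log_moebius]
    ext n
    simp
  rw [pmul_log_mul, hz, hm]
  ring

/-- The arithmetic function `n ↦ n ^ (-t)`, with value `0` at `0`. -/
noncomputable def rpowNeg (t : ℝ) : ArithmeticFunction ℝ :=
  ⟨fun n => if n = 0 then 0 else (n : ℝ) ^ (-t), if_pos rfl⟩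

lemma rpowNeg_apply {t : ℝ} {n : ℕ} (hn : n ≠ 0) : rpowNeg t n = (n : ℝ) ^ (-t) :=
  if_neg hn

lemma rpowNeg_map_mul (t : ℝ) (m n : ℕ) : rpowNeg t (m * n) = rpowNeg t m * rpowNeg t n := by
  rcases eq_or_ne m 0 with rfl | hm
  · simp
  rcases eq_or_ne n 0 with rfl | hn
  · simp
  rw [rpowNeg_apply hm, rpowNeg_apply hn, rpowNeg_apply (mul_ne_zero hm hn), Nat.cast_mul,
    Real.mul_rpow m.cast_nonneg n.cast_nonneg]

end ArithmeticFunction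

open ArithmeticFunction ArithmeticFunction.zeta ArithmeticFunction.Moebius in
lemma ft_eq_zeta_mul (t : ℝ) (m : ℕ) :
    ft t m = ((ζ : ArithmeticFunction ℝ) * pmul (rpowNeg t) μ) m := by
  rw [coe_zeta_mul_apply, ft]
  refine Finset.sum_congr rfl fun d hd => ?_
  rw [pmul_apply, rpowNeg_apply (Nat.pos_of_mem_divisors hd).ne', intCoe_apply,
    Real.rpow_neg d.cast_nonneg, div_eq_inv_mul]

/-- For every `t > 0` and `x ≥ 1`,
`Σ_{m≤x} f_t(m) log m = Σ_{kℓ≤x} f_t(k) Λ(ℓ) (1 − ℓ^{−t})`. -/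
theorem stmt_13 (t : ℝ) (ht : 0 < t) (x : ℝ) (hx : 1 ≤ x) :
    ∑ m ∈ Finset.Icc 1 ⌊x⌋₊, ft t m * Real.log m =
      ∑ m ∈ Finset.Icc 1 ⌊x⌋₊, ∑ p ∈ m.divisorsAntidiagonal,
        ft t p.1 * ArithmeticFunction.vonMangoldt p.2 * (1 - (p.2 : ℝ) ^ (-t)) := by
  refine Finset.sum_congr rfl fun m _ => ?_
  have key := DFunLike.congr_fun (ArithmeticFunction.pmul_log_zeta_mul_pmul_moebius
    (ArithmeticFunction.rpowNeg_map_mul t)) m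
  rw [ArithmeticFunction.pmul_apply, ← ft_eq_zeta_mul, ArithmeticFunction.mul_apply,
    ArithmeticFunction.log_apply] at key
  rw [mul_comm, key]
  refine Finset.sum_congr rfl fun p hp => ?_
  obtain ⟨rfl, hn⟩ := Nat.mem_divisorsAntidiagonal.1 hp
  rw [← ft_eq_zeta_mul, sub_eq_add_neg, ArithmeticFunction.add_apply,
    ArithmeticFunction.neg_apply, ArithmeticFunction.pmul_apply,
    ArithmeticFunction.rpowNeg_apply (mul_ne_zero_iff.1 hn).2]
  ring
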